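/- arXiv:1705.10886 — 8 statements merged into one kernel-verified Lean document; each statement's English description precedes it below -/
import Mathlib

section
/- Let x and y be vectors in ℝ^p and let δ be a real number with −1 ≤ δ < 1. If −⟨x, y⟩ ≤ δ‖x‖₂‖y‖₂, then ‖x + y‖₂ ≥ √((1 − δ)/2) · (‖x‖₂ + ‖y‖₂). -/
open scoped RealInnerProductSpace

/-- If `-⟪x, y⟫ ≤ δ ‖x‖ ‖y‖` with `-1 ≤ δ < 1`, then
`‖x + y‖ ≥ √((1 - δ)/2) (‖x‖ + ‖y‖)`. -/
theorem statement0 {p : ℕ} (x y : EuclideanSpace ℝ (Fin p)) (δ : ℝ)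
    (hδ₁ : -1 ≤ δ) (hδ₂ : δ < 1)
    (h : -⟪x, y⟫ ≤ δ * ‖x‖ * ‖y‖) :
    Real.sqrt ((1 - δ) / 2) * (‖x‖ + ‖y‖) ≤ ‖x + y‖ := by
  apply le_of_abs_le
  refine abs_le_of_sq_le_sq ?_ (norm_nonneg _)
  rw [mul_pow, Real.sq_sqrt (by linarith), norm_add_sq_real]
  nlinarith [mul_nonneg (by linarith : 0 ≤ 1 + δ) (sq_nonneg (‖x‖ - ‖y‖))]
end

section
/- Let C₁ and C₂ be cones in ℝ^p, each containing a nonzero vector, and let δ₀ = sup{ −⟨x, y⟩ : x ∈ C₁ ∩ S^{p−1}, y ∈ C₂ ∩ S^{p−1} }. If δ₀ < 1, then for all x ∈ C₁ and y ∈ C₂, ‖x + y‖₂ ≥ √((1 − δ₀)/2) · (‖x‖₂ + ‖y‖₂). -/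
open scoped RealInnerProductSpace

/-- A cone in `ℝ^p`: contains `0` and is closed under nonnegative scaling. -/
def IsCone {p : ℕ} (C : Set (EuclideanSpace ℝ (Fin p))) : Prop :=
  (0 : EuclideanSpace ℝ (Fin p)) ∈ C ∧ ∀ t : ℝ, 0 ≤ t → ∀ x ∈ C, t • x ∈ C

theorem IsCone.exists_unit {p : ℕ} {C : Set (EuclideanSpace ℝ (Fin p))} (h : IsCone C)
    {x : EuclideanSpace ℝ (Fin p)} (hx : x ∈ C) (hx0 : x ≠ 0) :
    ∃ u ∈ C, ‖u‖ = 1 ∧ x = ‖x‖ • u :=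
  ⟨‖x‖⁻¹ • x, h.2 _ (inv_nonneg.2 (norm_nonneg x)) x hx, by
    rw [norm_smul, norm_inv, norm_norm, inv_mul_cancel₀ (norm_ne_zero_iff.2 hx0)], by
    rw [smul_smul, mul_inv_cancel₀ (norm_ne_zero_iff.2 hx0), one_smul]⟩

/-- If `-⟪x, y⟫ ≤ δ ‖x‖ ‖y‖` with `δ ≥ -1`, then `‖x + y‖` controls `‖x‖ + ‖y‖`. -/
theorem sqrt_mul_norm_add_norm_le {E : Type*} [NormedAddCommGroup E] [InnerProductSpace ℝ E]
    {x y : E} {δ : ℝ} (hδ : -1 ≤ δ) (h : -⟪x, y⟫ ≤ δ * (‖x‖ * ‖y‖)) :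
    Real.sqrt ((1 - δ) / 2) * (‖x‖ + ‖y‖) ≤ ‖x + y‖ := by
  rcases le_total δ 1 with hδ1 | hδ1
  · refine abs_le_of_sq_le_sq' ?_ (norm_nonneg _) |>.2
    rw [mul_pow, Real.sq_sqrt (by linarith), norm_add_sq_real]
    nlinarith [mul_nonneg (neg_le_iff_add_nonneg.1 hδ) (sq_nonneg (‖x‖ - ‖y‖))]
  · rw [Real.sqrt_eq_zero_of_nonpos (by linarith), zero_mul]
    exact norm_nonneg _

/-- For cones `C₁, C₂`, each containing a nonzero vector, with
`δ₀ = sup { -⟪x, y⟫ : x ∈ C₁ ∩ S^{p-1}, y ∈ C₂ ∩ S^{p-1} } < 1`, every `x ∈ C₁`, `y ∈ C₂`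
satisfy `‖x + y‖ ≥ √((1 - δ₀)/2) (‖x‖ + ‖y‖)`. -/
theorem statement1 {p : ℕ} (C₁ C₂ : Set (EuclideanSpace ℝ (Fin p)))
    (h₁ : IsCone C₁) (h₂ : IsCone C₂)
    (hne₁ : ∃ x ∈ C₁, x ≠ 0) (hne₂ : ∃ y ∈ C₂, y ≠ 0)
    (δ₀ : ℝ)
    (hδ₀ : δ₀ = sSup {d : ℝ | ∃ x ∈ C₁, ∃ y ∈ C₂, ‖x‖ = 1 ∧ ‖y‖ = 1 ∧ d = -⟪x, y⟫})
    (hlt : δ₀ < 1) :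
    ∀ x ∈ C₁, ∀ y ∈ C₂, Real.sqrt ((1 - δ₀) / 2) * (‖x‖ + ‖y‖) ≤ ‖x + y‖ := by
  have abs_inner_le : ∀ u v : EuclideanSpace ℝ (Fin p), ‖u‖ = 1 → ‖v‖ = 1 → |⟪u, v⟫| ≤ 1 :=
    fun u v hu hv => by simpa [hu, hv] using abs_real_inner_le_norm u v
  have le_δ₀ : ∀ u ∈ C₁, ∀ v ∈ C₂, ‖u‖ = 1 → ‖v‖ = 1 → -⟪u, v⟫ ≤ δ₀ := by
    intro u hu v hv hu1 hv1
    rw [hδ₀]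
    refine le_csSup ⟨1, ?_⟩ ⟨u, hu, v, hv, hu1, hv1, rfl⟩
    rintro _ ⟨a, -, b, -, ha, hb, rfl⟩
    exact neg_le.1 (abs_le.1 (abs_inner_le a b ha hb)).1
  have neg_one_le : -1 ≤ δ₀ := by
    obtain ⟨x, hx, hx0⟩ := hne₁
    obtain ⟨y, hy, hy0⟩ := hne₂
    obtain ⟨u, hu, hu1, -⟩ := h₁.exists_unit hx hx0
    obtain ⟨v, hv, hv1, -⟩ := h₂.exists_unit hy hy0
    exact (neg_le_neg (abs_le.1 (abs_inner_le u v hu1 hv1)).2).trans (le_δ₀ u hu v hv hu1 hv1)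
  intro x hx y hy
  refine sqrt_mul_norm_add_norm_le neg_one_le ?_
  rcases eq_or_ne x 0 with rfl | hx0
  · simp
  rcases eq_or_ne y 0 with rfl | hy0
  · simp
  obtain ⟨u, hu, hu1, hxu⟩ := h₁.exists_unit hx hx0
  obtain ⟨v, hv, hv1, hyv⟩ := h₂.exists_unit hy hy0
  have inner_eq : ⟪x, y⟫ = ‖x‖ * ‖y‖ * ⟪u, v⟫ := by
    conv_lhs => rw [hxu, hyv, real_inner_smul_left, real_inner_smul_right, ← mul_assoc]
  rw [inner_eq, ← mul_neg, mul_comm δ₀]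
  exact mul_le_mul_of_nonneg_left (le_δ₀ u hu v hv hu1 hv1) (by positivity)
end

section
/- Let k ≥ 2 and let C₁,…,C_k be cones in ℝ^p, each containing a nonzero vector. For each i define δ_i = sup{ ⟨u, v⟩ : u ∈ (−C_i) ∩ S^{p−1}, v ∈ (Σ_{j≠i} C_j) ∩ S^{p−1} }, where Σ_{j≠i} C_j is the Minkowski sum of the cones C_j over j ≠ i, and let δ = max_i δ_i. If δ < 1, then for all Δ_i ∈ C_i (i = 1,…,k), ‖Σ_{i=1}^k Δ_i‖₂ ≥ ρ · Σ_{i=1}^k ‖Δ_i‖₂ with ρ = (1/k)·√((1 − δ)/2); in particular the structural coherence condition holds with a constant ρ > 0. -/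
open scoped RealInnerProductSpace BigOperators

/-- The Minkowski sum `Σ_{j ≠ i} C_j` of a family of sets of `ℝ^p`. -/
def sumExcept {p k : ℕ} (C : Fin k → Set (EuclideanSpace ℝ (Fin p))) (i : Fin k) :
    Set (EuclideanSpace ℝ (Fin p)) :=
  {v | ∃ g : Fin k → EuclideanSpace ℝ (Fin p),
    (∀ j, j ≠ i → g j ∈ C j) ∧ v = ∑ j ∈ Finset.univ.erase i, g j}

/-- `δ_i = sup { ⟪u, v⟫ : u ∈ (-C_i) ∩ S^{p-1}, v ∈ (Σ_{j ≠ i} C_j) ∩ S^{p-1} }`. -/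
noncomputable def coneDelta {p k : ℕ} (C : Fin k → Set (EuclideanSpace ℝ (Fin p)))
    (i : Fin k) : ℝ :=
  sSup {d : ℝ | ∃ u, -u ∈ C i ∧ ‖u‖ = 1 ∧ ∃ v ∈ sumExcept C i, ‖v‖ = 1 ∧ d = ⟪u, v⟫}

theorem smul_mem_sumExcept {p k : ℕ} {C : Fin k → Set (EuclideanSpace ℝ (Fin p))}
    (hC : ∀ i, IsCone (C i)) (i : Fin k) {t : ℝ} (ht : 0 ≤ t) {v : EuclideanSpace ℝ (Fin p)}
    (hv : v ∈ sumExcept C i) : t • v ∈ sumExcept C i := by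
  obtain ⟨g, hg, rfl⟩ := hv
  exact ⟨fun j => t • g j, fun j hj => (hC j).2 t ht _ (hg j hj), Finset.smul_sum⟩

theorem subset_sumExcept {p k : ℕ} {C : Fin k → Set (EuclideanSpace ℝ (Fin p))}
    (hC : ∀ i, IsCone (C i)) {i j : Fin k} (hji : j ≠ i) : C j ⊆ sumExcept C i := by
  intro x hx
  refine ⟨Pi.single j x, fun l _ => ?_, ?_⟩
  · by_cases hl : l = j
    · subst hl; simpa using hx
    · simpa [Pi.single_eq_of_ne hl] using (hC l).1
  · rw [Finset.sum_eq_single_of_mem j (by simp [hji])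
      fun l _ hl => by simp [hl], Pi.single_eq_same]

theorem norm_inv_norm_smul {E : Type*} [NormedAddCommGroup E] [NormedSpace ℝ E] {x : E}
    (hx : x ≠ 0) : ‖‖x‖⁻¹ • x‖ = 1 := by
  simpa using norm_smul_inv_norm (𝕜 := ℝ) hx

theorem inner_le_coneDelta {p k : ℕ} {C : Fin k → Set (EuclideanSpace ℝ (Fin p))} {i : Fin k}
    {u v : EuclideanSpace ℝ (Fin p)} (hu : -u ∈ C i) (hu1 : ‖u‖ = 1)
    (hv : v ∈ sumExcept C i) (hv1 : ‖v‖ = 1) : ⟪u, v⟫ ≤ coneDelta C i := by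
  refine le_csSup ⟨1, ?_⟩ ⟨u, hu, hu1, v, hv, hv1, rfl⟩
  rintro _ ⟨u, -, hu, v, -, hv, rfl⟩
  simpa [hu, hv] using real_inner_le_norm u v

theorem neg_inner_le_coneDelta_mul {p k : ℕ} {C : Fin k → Set (EuclideanSpace ℝ (Fin p))}
    (hC : ∀ i, IsCone (C i)) {i : Fin k} {x y : EuclideanSpace ℝ (Fin p)} (hx : x ∈ C i)
    (hy : y ∈ sumExcept C i) : -⟪x, y⟫ ≤ coneDelta C i * (‖x‖ * ‖y‖) := by
  rcases eq_or_ne x 0 with rfl | hx0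
  · simp
  rcases eq_or_ne y 0 with rfl | hy0
  · simp
  have h := inner_le_coneDelta (C := C) (i := i) (u := -(‖x‖⁻¹ • x)) (v := ‖y‖⁻¹ • y)
    (by rw [neg_neg]; exact (hC i).2 _ (by positivity) _ hx)
    (by rw [norm_neg, norm_inv_norm_smul hx0])
    (smul_mem_sumExcept hC i (by positivity) hy) (norm_inv_norm_smul hy0)
  have hpos : 0 < ‖x‖ * ‖y‖ := mul_pos (norm_pos_iff.2 hx0) (norm_pos_iff.2 hy0)
  rw [inner_neg_left, real_inner_smul_left, real_inner_smul_right] at h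
  rw [← div_le_iff₀ hpos]
  refine le_of_eq_of_le ?_ h
  have := norm_ne_zero_iff.2 hx0
  have := norm_ne_zero_iff.2 hy0
  field_simp

theorem neg_one_le_coneDelta {p k : ℕ} {C : Fin k → Set (EuclideanSpace ℝ (Fin p))}
    (hC : ∀ i, IsCone (C i)) {i j : Fin k} (hji : j ≠ i) (hi : ∃ x ∈ C i, x ≠ 0)
    (hj : ∃ x ∈ C j, x ≠ 0) : -1 ≤ coneDelta C i := by
  obtain ⟨x, hx, hx0⟩ := hi
  obtain ⟨y, hy, hy0⟩ := hj
  have h := neg_inner_le_coneDelta_mul hC hx (subset_sumExcept hC hji hy)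
  have hpos : 0 < ‖x‖ * ‖y‖ := mul_pos (norm_pos_iff.2 hx0) (norm_pos_iff.2 hy0)
  have := real_inner_le_norm x y
  nlinarith

theorem sqrt_mul_norm_le_norm_add {E : Type*} [NormedAddCommGroup E] [InnerProductSpace ℝ E]
    {δ : ℝ} (hδ : -1 ≤ δ) (hδ' : δ ≤ 1) {x y : E} (h : -⟪x, y⟫ ≤ δ * (‖x‖ * ‖y‖)) :
    √((1 - δ) / 2) * ‖x‖ ≤ ‖x + y‖ := by
  refine (abs_le_of_sq_le_sq' ?_ (norm_nonneg _)).2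
  rw [mul_pow, Real.sq_sqrt (by linarith), norm_add_sq_real]
  have hxy : 0 ≤ ‖x‖ * ‖y‖ := by positivity
  nlinarith [mul_nonneg (by linarith : 0 ≤ 1 + δ) (sq_nonneg (‖x‖ - ‖y‖)),
    mul_nonneg (by linarith : 0 ≤ 1 - δ) hxy,
    mul_nonneg (by linarith : 0 ≤ 1 - δ) (sq_nonneg ‖y‖)]

/-- If `δ = max_i δ_i < 1` then the structural coherence condition holds
with `ρ = (1/k)√((1 - δ)/2)`; in particular it holds with some constant `ρ > 0`. -/
theorem statement2 {p k : ℕ} (hk : 2 ≤ k)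
    (C : Fin k → Set (EuclideanSpace ℝ (Fin p)))
    (hC : ∀ i, IsCone (C i)) (hne : ∀ i, ∃ x ∈ C i, x ≠ 0)
    (δ : ℝ) (hδ : δ = ⨆ i, coneDelta C i) (hlt : δ < 1) :
    (∀ Δ : Fin k → EuclideanSpace ℝ (Fin p), (∀ i, Δ i ∈ C i) →
      ((1 / (k : ℝ)) * Real.sqrt ((1 - δ) / 2)) * ∑ i, ‖Δ i‖ ≤ ‖∑ i, Δ i‖) ∧
    ∃ ρ : ℝ, 0 < ρ ∧ ∀ Δ : Fin k → EuclideanSpace ℝ (Fin p), (∀ i, Δ i ∈ C i) →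
      ρ * ∑ i, ‖Δ i‖ ≤ ‖∑ i, Δ i‖ := by
  have hbdd : BddAbove (Set.range (coneDelta C)) := (Set.finite_range _).bddAbove
  have hle : ∀ i, coneDelta C i ≤ δ := fun i => hδ ▸ le_ciSup hbdd i
  have hk0 : (0 : ℝ) < k := by exact_mod_cast (by omega : 0 < k)
  have hδ1 : -1 ≤ δ :=
    (neg_one_le_coneDelta hC (i := ⟨0, by omega⟩) (j := ⟨1, by omega⟩) (by simp)
      (hne _) (hne _)).trans (hle _)
  have hmain : ∀ Δ : Fin k → EuclideanSpace ℝ (Fin p), (∀ i, Δ i ∈ C i) →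
      ((1 / (k : ℝ)) * Real.sqrt ((1 - δ) / 2)) * ∑ i, ‖Δ i‖ ≤ ‖∑ i, Δ i‖ := by
    intro Δ hΔ
    have hterm : ∀ i, √((1 - δ) / 2) * ‖Δ i‖ ≤ ‖∑ j, Δ j‖ := by
      intro i
      rw [← Finset.add_sum_erase _ _ (Finset.mem_univ i)]
      refine sqrt_mul_norm_le_norm_add hδ1 hlt.le ?_
      exact (neg_inner_le_coneDelta_mul hC (hΔ i) ⟨Δ, fun j _ => hΔ j, rfl⟩).trans
        (mul_le_mul_of_nonneg_right (hle i) (by positivity))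
    have hsum := Finset.sum_le_sum fun i (_ : i ∈ Finset.univ) => hterm i
    rw [← Finset.mul_sum, Finset.sum_const, Finset.card_univ, Fintype.card_fin,
      nsmul_eq_mul] at hsum
    rwa [mul_assoc, one_div, inv_mul_le_iff₀ hk0]
  exact ⟨hmain, _, mul_pos (by positivity) (Real.sqrt_pos.2 (by linarith)), hmain⟩
end

section
/- Let C₁,…,C_k be cones in ℝ^p, not all equal to {0}, satisfying the structural coherence condition with constant ρ > 0. Let H = {Σ_{i=1}^k u_i : u_i ∈ C_i for each i and Σ_{i=1}^k ‖u_i‖₂ = 1} and A = (C₁ + ⋯ + C_k) ∩ S^{p−1} (Minkowski sum intersected with the unit sphere). Let Z be a random vector in ℝ^p defined on a probability space, and for a set E ⊆ ℝ^p and ξ > 0 define the marginal tail function Q_ξ(E; Z) = inf_{u ∈ E} P(|⟨Z, u⟩| ≥ ξ). Then for every ξ > 0, Q_{ρξ}(H; Z) ≥ Q_ξ(A; Z). -/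
open scoped RealInnerProductSpace BigOperators
open MeasureTheory

/-- The marginal tail function `Q_ξ(E; Z) = inf_{u ∈ E} P(|⟪Z, u⟫| ≥ ξ)`. -/
noncomputable def marginalTail {p : ℕ} {Ω : Type*} [MeasurableSpace Ω]
    (μ : Measure Ω) (E : Set (EuclideanSpace ℝ (Fin p)))
    (Z : Ω → EuclideanSpace ℝ (Fin p)) (ξ : ℝ) : ENNReal :=
  ⨅ u ∈ E, μ {ω | ξ ≤ |⟪Z ω, u⟫|}

/-- Under structural coherence with constant `ρ > 0`, for every `ξ > 0`,
`Q_{ρξ}(H; Z) ≥ Q_ξ(A; Z)` where `H = {Σ u_i : u_i ∈ C_i, Σ‖u_i‖ = 1}` and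
`A = (C₁ + ⋯ + C_k) ∩ S^{p-1}`. -/
theorem statement4 {p k : ℕ}
    (C : Fin k → Set (EuclideanSpace ℝ (Fin p))) (hC : ∀ i, IsCone (C i))
    (hne : ∃ i, ∃ x ∈ C i, x ≠ 0)
    (ρ : ℝ) (hρ : 0 < ρ)
    (hSC : ∀ Δ : Fin k → EuclideanSpace ℝ (Fin p), (∀ i, Δ i ∈ C i) →
      ρ * ∑ i, ‖Δ i‖ ≤ ‖∑ i, Δ i‖)
    (H A : Set (EuclideanSpace ℝ (Fin p)))
    (hH : H = {u | ∃ v : Fin k → EuclideanSpace ℝ (Fin p),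
      (∀ i, v i ∈ C i) ∧ (∑ i, ‖v i‖) = 1 ∧ u = ∑ i, v i})
    (hA : A = {u | (∃ v : Fin k → EuclideanSpace ℝ (Fin p),
      (∀ i, v i ∈ C i) ∧ u = ∑ i, v i) ∧ ‖u‖ = 1})
    {Ω : Type*} [MeasurableSpace Ω] (μ : Measure Ω) [IsProbabilityMeasure μ]
    (Z : Ω → EuclideanSpace ℝ (Fin p)) (hZ : Measurable Z)
    (ξ : ℝ) (hξ : 0 < ξ) :
    marginalTail μ A Z ξ ≤ marginalTail μ H Z (ρ * ξ) := by
  subst hH hA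
  refine le_iInf₂ ?_
  rintro _ ⟨v, hv, hsum, rfl⟩
  set u := ∑ i, v i
  have hnorm : ρ ≤ ‖u‖ := by simpa [hsum] using hSC v hv
  have hpos : 0 < ‖u‖ := hρ.trans_le hnorm
  have hmem : ‖u‖⁻¹ • u ∈ {u | (∃ v : Fin k → EuclideanSpace ℝ (Fin p),
      (∀ i, v i ∈ C i) ∧ u = ∑ i, v i) ∧ ‖u‖ = 1} :=
    ⟨⟨fun i => ‖u‖⁻¹ • v i, fun i => (hC i).2 _ (inv_nonneg.2 hpos.le) _ (hv i), by
      rw [← Finset.smul_sum]⟩, by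
      rw [norm_smul, norm_inv, norm_norm, inv_mul_cancel₀ hpos.ne']⟩
  refine (iInf₂_le _ hmem).trans (measure_mono fun ω hω => ?_)
  simp only [Set.mem_ofPred_eq, real_inner_smul_right, abs_mul, abs_inv, abs_norm] at hω ⊢
  calc ρ * ξ ≤ ‖u‖ * ξ := by gcongr
    _ ≤ ‖u‖ * (‖u‖⁻¹ * |⟪Z ω, u⟫|) := by gcongr
    _ = |⟪Z ω, u⟫| := mul_inv_cancel_left₀ hpos.ne' _
end

section
/- Let C₁,…,C_k be cones in ℝ^p, each containing a nonzero vector, and let H = {Σ_{i=1}^k u_i : u_i ∈ C_i for each i and Σ_{i=1}^k ‖u_i‖₂ = 1}. Then for every vector g ∈ ℝ^p, sup_{u ∈ H} ⟨g, u⟩ = max_{1 ≤ i ≤ k} sup_{v ∈ C_i ∩ S^{p−1}} ⟨g, v⟩. -/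
open scoped RealInnerProductSpace BigOperators

/-- The inner products of `g` with the unit vectors of a set are bounded above. -/
lemma bddAbove_inner_image_unit {E : Type*} [NormedAddCommGroup E] [InnerProductSpace ℝ E]
    (S : Set E) (g : E) :
    BddAbove ((fun v => ⟪g, v⟫) '' (S ∩ {v | ‖v‖ = 1})) := by
  refine ⟨‖g‖, ?_⟩
  rintro _ ⟨v, ⟨-, hv : ‖v‖ = 1⟩, rfl⟩
  simpa [hv] using real_inner_le_norm g v

lemma IsCone.inv_norm_smul_mem {p : ℕ} {C : Set (EuclideanSpace ℝ (Fin p))} (hC : IsCone C)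
    {x : EuclideanSpace ℝ (Fin p)} (hx : x ∈ C) (hx0 : x ≠ 0) :
    ‖x‖⁻¹ • x ∈ C ∩ {v | ‖v‖ = 1} :=
  ⟨hC.2 _ (by positivity) x hx, by
    simp [norm_smul, inv_mul_cancel₀ (norm_ne_zero_iff.mpr hx0)]⟩

lemma IsCone.inner_le_norm_mul_sSup {p : ℕ} {C : Set (EuclideanSpace ℝ (Fin p))}
    (hC : IsCone C) (g : EuclideanSpace ℝ (Fin p)) {x : EuclideanSpace ℝ (Fin p)} (hx : x ∈ C) :
    ⟪g, x⟫ ≤ ‖x‖ * sSup ((fun v => ⟪g, v⟫) '' (C ∩ {v | ‖v‖ = 1})) := by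
  rcases eq_or_ne x 0 with rfl | hx0
  · simp
  · have h := le_csSup (bddAbove_inner_image_unit C g)
      (Set.mem_image_of_mem _ (hC.inv_norm_smul_mem hx hx0))
    simp only [real_inner_smul_right] at h
    rwa [inv_mul_le_iff₀ (norm_pos_iff.mpr hx0)] at h

/-- For `H = {Σ u_i : u_i ∈ C_i, Σ‖u_i‖ = 1}` and any `g ∈ ℝ^p`,
`sup_{u ∈ H} ⟪g, u⟫ = max_i sup_{v ∈ C_i ∩ S^{p-1}} ⟪g, v⟫`. -/
theorem statement6 {p k : ℕ} (hk : 1 ≤ k)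
    (C : Fin k → Set (EuclideanSpace ℝ (Fin p)))
    (hC : ∀ i, IsCone (C i)) (hne : ∀ i, ∃ x ∈ C i, x ≠ 0)
    (g : EuclideanSpace ℝ (Fin p)) :
    sSup ((fun u => ⟪g, u⟫) ''
        {u | ∃ v : Fin k → EuclideanSpace ℝ (Fin p),
          (∀ i, v i ∈ C i) ∧ (∑ i, ‖v i‖) = 1 ∧ u = ∑ i, v i})
      = ⨆ i, sSup ((fun v => ⟪g, v⟫) '' (C i ∩ {v | ‖v‖ = 1})) := by
  have : Nonempty (Fin k) := ⟨⟨0, hk⟩⟩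
  set s : Fin k → ℝ := fun i => sSup ((fun v => ⟪g, v⟫) '' (C i ∩ {v | ‖v‖ = 1}))
  set H : Set (EuclideanSpace ℝ (Fin p)) :=
    {u | ∃ v : Fin k → EuclideanSpace ℝ (Fin p),
      (∀ i, v i ∈ C i) ∧ (∑ i, ‖v i‖) = 1 ∧ u = ∑ i, v i}
  have unit_nonempty : ∀ i, (C i ∩ {v | ‖v‖ = 1}).Nonempty := fun i => by
    obtain ⟨x, hx, hx0⟩ := hne i
    exact ⟨_, (hC i).inv_norm_smul_mem hx hx0⟩
  have unit_subset : ∀ i, C i ∩ {v | ‖v‖ = 1} ⊆ H := by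
    rintro i w ⟨hw, hw1 : ‖w‖ = 1⟩
    refine ⟨Pi.single i w, fun j => ?_, ?_, by simp⟩
    · rcases eq_or_ne j i with rfl | hj
      · simpa using hw
      · simpa [hj] using (hC j).1
    · rw [Finset.sum_eq_single i (fun j _ hj => by simp [hj]) (by simp)]
      simpa using hw1
  have le_sup : ∀ r ∈ (fun u => ⟪g, u⟫) '' H, r ≤ ⨆ i, s i := by
    rintro _ ⟨_, ⟨v, hv, hv1, rfl⟩, rfl⟩
    calc ⟪g, ∑ i, v i⟫ = ∑ i, ⟪g, v i⟫ := inner_sum _ _ _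
      _ ≤ ∑ i, ‖v i‖ * ⨆ j, s j := Finset.sum_le_sum fun i _ =>
          ((hC i).inner_le_norm_mul_sSup g (hv i)).trans <|
            mul_le_mul_of_nonneg_left (le_ciSup (Set.finite_range s).bddAbove i) (norm_nonneg _)
      _ = ⨆ i, s i := by rw [← Finset.sum_mul, hv1, one_mul]
  apply le_antisymm
  · exact csSup_le (((unit_nonempty ⟨0, hk⟩).mono (unit_subset _)).image _) le_sup
  · exact ciSup_le fun i => csSup_le_csSup ⟨_, le_sup⟩ ((unit_nonempty i).image _)
      (Set.image_mono (unit_subset i))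
end

section
/- Let k ≥ 1 and let C₁,…,C_k be closed cones in ℝ^p, each containing a nonzero vector, and let H = {Σ_{i=1}^k u_i : u_i ∈ C_i for each i and Σ_{i=1}^k ‖u_i‖₂ = 1}. Then the Gaussian width of H satisfies w(H) ≤ max_{1 ≤ i ≤ k} w(C_i ∩ S^{p−1}) + √(2 log k) + √(π/2). -/
open scoped RealInnerProductSpace BigOperators
open MeasureTheory

/-- The Gaussian width `w(T) = E[sup_{u ∈ T} ⟪g, u⟫]`, where `g ~ N(0, I_p)`. -/
noncomputable def gaussianWidth {p : ℕ} (T : Set (EuclideanSpace ℝ (Fin p))) : ℝ :=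
  ∫ g : Fin p → ℝ,
    sSup ((fun u : EuclideanSpace ℝ (Fin p) => ∑ i, g i * u i) '' T)
      ∂(Measure.pi fun _ : Fin p => ProbabilityTheory.gaussianReal 0 1)

open Set Filter Topology ProbabilityTheory

/-- The quantile function of the probability density `u / ∫ u`, with its derivative. -/
theorem exists_quantile {u : ℝ → ℝ} (hu : Continuous u) (hpos : ∀ x, 0 < u x)
    (hint : Integrable u) :
    ∃ q : ℝ → ℝ, ∀ s ∈ Ioo (0 : ℝ) 1, HasDerivAt q ((∫ x, u x) / u (q s)) s := by
  set Z := ∫ x, u x with hZ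
  have hZpos : 0 < Z := integral_pos_of_integrable_nonneg_nonzero (x := 0) hu hint
    (fun x => (hpos x).le) (hpos 0).ne'
  set G : ℝ → ℝ := fun x => (∫ y in Iic x, u y) / Z with hG
  have hGeq : ∀ x, G x = ((∫ y in Iic (0 : ℝ), u y) + ∫ y in (0 : ℝ)..x, u y) / Z := by
    intro x
    simp only [hG]
    rw [← intervalIntegral.integral_Iic_sub_Iic hint.integrableOn hint.integrableOn]
    ring
  have hderiv : ∀ x, HasDerivAt G (u x / Z) x := by
    intro x
    have h := intervalIntegral.integral_hasDerivAt_right (a := 0) (b := x) (f := u)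
      hint.intervalIntegrable hu.stronglyMeasurable.stronglyMeasurableAtFilter hu.continuousAt
    rw [funext hGeq]
    exact (h.const_add _).div_const Z
  have hcont : Continuous G := continuous_iff_continuousAt.2 fun x => (hderiv x).continuousAt
  have hmono : StrictMono G := strictMono_of_hasDerivAt_pos hderiv
    fun x => div_pos (hpos x) hZpos
  have hbot : Tendsto G atBot (𝓝 0) := by
    have h := tendsto_integral_Iic_zero (f := u) (μ := volume) (l := atBot) (a := id) tendsto_id
    simpa using h.div_const Z
  have htop : Tendsto G atTop (𝓝 1) := by
    have h := ((aecover_Iic (μ := volume) tendsto_id).integral_tendsto_of_countably_generated hint).div_const Z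
    rwa [← hZ, div_self hZpos.ne'] at h
  have hrange : ∀ x, G x ∈ Ioo (0 : ℝ) 1 := by
    intro x
    constructor
    · exact lt_of_le_of_lt (hmono.monotone.le_of_tendsto hbot (x - 1)) (hmono (by linarith))
    · exact lt_of_lt_of_le (hmono (by linarith : x < x + 1))
        (hmono.monotone.ge_of_tendsto htop (x + 1))
  have hsurj : ∀ s ∈ Ioo (0 : ℝ) 1, ∃ x, G x = s := by
    intro s hs
    obtain ⟨a, ha⟩ := (hbot.eventually (gt_mem_nhds hs.1)).exists
    obtain ⟨b, hb⟩ := (htop.eventually (lt_mem_nhds hs.2)).exists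
    exact mem_range_of_exists_le_of_exists_ge hcont ⟨a, ha.le⟩ ⟨b, hb.le⟩
  refine ⟨Function.invFun G, fun s hs => ?_⟩
  have hinv : ∀ r ∈ Ioo (0 : ℝ) 1, G (Function.invFun G r) = r := fun r hr =>
    Function.invFun_eq (hsurj r hr)
  have hnhds : Ioo (0 : ℝ) 1 ∈ 𝓝 s := Ioo_mem_nhds hs.1 hs.2
  have hqmono : MonotoneOn (Function.invFun G) (Ioo 0 1) := by
    intro r hr r' hr' hrr
    rwa [← hmono.le_iff_le, hinv r hr, hinv r' hr']
  have himage : Function.invFun G '' Ioo 0 1 = univ := by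
    refine eq_univ_of_forall fun x => ⟨G x, hrange x, ?_⟩
    exact Function.leftInverse_invFun hmono.injective x
  have hqc : ContinuousAt (Function.invFun G) s :=
    continuousAt_of_monotoneOn_of_image_mem_nhds hqmono hnhds (by rw [himage]; exact univ_mem)
  have h := HasDerivAt.of_local_left_inverse hqc (hderiv _) (div_pos (hpos _) hZpos).ne'
    (by filter_upwards [hnhds] with r hr using hinv r hr)
  rwa [inv_div] at h

/-- The Prékopa–Leindler inequality on the real line, for positive continuous functions. -/
theorem prekopa_leindler_real {u v h : ℝ → ℝ} {t : ℝ} (ht : t ∈ Ioo (0 : ℝ) 1)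
    (hu : Continuous u) (hupos : ∀ x, 0 < u x) (huint : Integrable u)
    (hv : Continuous v) (hvpos : ∀ x, 0 < v x) (hvint : Integrable v)
    (hnn : ∀ x, 0 ≤ h x) (hint : Integrable h)
    (huv : ∀ x y, u x ^ (1 - t) * v y ^ t ≤ h ((1 - t) * x + t * y)) :
    (∫ x, u x) ^ (1 - t) * (∫ x, v x) ^ t ≤ ∫ x, h x := by
  obtain ⟨p, hp⟩ := exists_quantile hu hupos huint
  obtain ⟨q, hq⟩ := exists_quantile hv hvpos hvint
  set Z := ∫ x, u x
  set W := ∫ x, v x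
  have ht0 : 0 < t := ht.1
  have ht1 : 0 < 1 - t := by linarith [ht.2]
  have hZ : 0 < Z := integral_pos_of_integrable_nonneg_nonzero (x := 0) hu huint
    (fun x => (hupos x).le) (hupos 0).ne'
  have hW : 0 < W := integral_pos_of_integrable_nonneg_nonzero (x := 0) hv hvint
    (fun x => (hvpos x).le) (hvpos 0).ne'
  set z : ℝ → ℝ := fun s => (1 - t) * p s + t * q s
  set z' : ℝ → ℝ := fun s => (1 - t) * (Z / u (p s)) + t * (W / v (q s))
  have hz : ∀ s ∈ Ioo (0 : ℝ) 1, HasDerivAt z (z' s) s := fun s hs =>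
    ((hp s hs).const_mul _).add ((hq s hs).const_mul _)
  have hz'pos : ∀ s, 0 < z' s := fun s => by
    have := div_pos hZ (hupos (p s))
    have := div_pos hW (hvpos (q s))
    positivity
  have hmono : StrictMonoOn z (Ioo 0 1) := by
    refine strictMonoOn_of_hasDerivWithinAt_pos (f' := z') (convex_Ioo 0 1)
      (fun s hs => (hz s hs).continuousAt.continuousWithinAt) ?_ ?_
    · intro s hs
      rw [interior_Ioo] at hs ⊢
      exact (hz s hs).hasDerivWithinAt
    · exact fun s _ => hz'pos s
  have hkey : ∀ s, Z ^ (1 - t) * W ^ t ≤ |z' s| * h (z s) := by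
    intro s
    have hU := hupos (p s)
    have hV := hvpos (q s)
    have h1 : (Z / u (p s)) ^ (1 - t) * (W / v (q s)) ^ t ≤ z' s :=
      Real.geom_mean_le_arith_mean2_weighted ht1.le ht0.le (div_pos hZ hU).le
        (div_pos hW hV).le (by ring)
    rw [abs_of_pos (hz'pos s)]
    calc Z ^ (1 - t) * W ^ t
        = ((Z / u (p s)) ^ (1 - t) * (W / v (q s)) ^ t) * (u (p s) ^ (1 - t) * v (q s) ^ t) := by
          rw [Real.div_rpow hZ.le hU.le, Real.div_rpow hW.le hV.le]
          have := (Real.rpow_pos_of_pos hU (1 - t)).ne'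
          have := (Real.rpow_pos_of_pos hV t).ne'
          field_simp
      _ ≤ z' s * h (z s) := by
          have := hz'pos s
          gcongr
          exact huv _ _
  have hlin : ENNReal.ofReal (Z ^ (1 - t) * W ^ t) ≤ ENNReal.ofReal (∫ x, h x) := by
    rw [ofReal_integral_eq_lintegral_ofReal hint (ae_of_all _ hnn)]
    calc ENNReal.ofReal (Z ^ (1 - t) * W ^ t)
        = ∫⁻ _ in Ioo (0 : ℝ) 1, ENNReal.ofReal (Z ^ (1 - t) * W ^ t) := by simp
      _ ≤ ∫⁻ s in Ioo (0 : ℝ) 1, ENNReal.ofReal |z' s| * ENNReal.ofReal (h (z s)) := by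
          refine lintegral_mono fun s => ?_
          rw [← ENNReal.ofReal_mul (abs_nonneg _)]
          exact ENNReal.ofReal_le_ofReal (hkey s)
      _ = ∫⁻ x in z '' Ioo 0 1, ENNReal.ofReal (h x) :=
          (lintegral_image_eq_lintegral_abs_deriv_mul measurableSet_Ioo
            (fun s hs => (hz s hs).hasDerivWithinAt) hmono.injOn
            fun x => ENNReal.ofReal (h x)).symm
      _ ≤ ∫⁻ x, ENNReal.ofReal (h x) := setLIntegral_le_lintegral _ _
  exact (ENNReal.ofReal_le_ofReal_iff (integral_nonneg hnn)).1 hlin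

theorem integrable_exp_of_lipschitzWith {n : ℕ} {K : NNReal} {a : (Fin n → ℝ) → ℝ}
    (ha : LipschitzWith K a) :
    Integrable (fun x => Real.exp (a x)) (Measure.pi fun _ : Fin n => gaussianReal 0 1) := by
  have h1 : Integrable (fun x : Fin n → ℝ => ∏ i, Real.exp (K * |x i|))
      (Measure.pi fun _ : Fin n => gaussianReal 0 1) :=
    Integrable.fintype_prod (f := fun _ (s : ℝ) => Real.exp (K * |s|)) fun _ =>
      integrable_exp_mul_abs (integrable_exp_mul_gaussianReal _) (integrable_exp_mul_gaussianReal _)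
  refine (h1.const_mul (Real.exp (a 0))).mono'
    (Real.continuous_exp.comp ha.continuous).aestronglyMeasurable (ae_of_all _ fun x => ?_)
  rw [Real.norm_eq_abs, abs_of_pos (Real.exp_pos _), ← Real.exp_sum, ← Real.exp_add,
    Real.exp_le_exp, ← Finset.mul_sum]
  have h2 : ‖x‖ ≤ ∑ i, |x i| :=
    (pi_norm_le_iff_of_nonneg (Finset.sum_nonneg fun i _ => abs_nonneg _)).2 fun i =>
      Finset.single_le_sum (f := fun i => |x i|) (fun i _ => abs_nonneg _) (Finset.mem_univ i)
  have h3 := ha.dist_le_mul x 0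
  rw [Real.dist_eq, dist_zero_right] at h3
  have h4 := mul_le_mul_of_nonneg_left h2 K.coe_nonneg
  linarith [le_abs_self (a x - a 0)]

theorem integrable_of_lipschitzWith {n : ℕ} {K : NNReal} {a : (Fin n → ℝ) → ℝ}
    (ha : LipschitzWith K a) :
    Integrable a (Measure.pi fun _ : Fin n => gaussianReal 0 1) := by
  refine ((integrable_exp_of_lipschitzWith ha).add
    (integrable_exp_of_lipschitzWith ha.neg)).mono' ha.continuous.aestronglyMeasurable
    (ae_of_all _ fun x => ?_)
  simp only [Pi.add_apply, Pi.neg_apply]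
  rw [Real.norm_eq_abs, abs_le]
  constructor <;> linarith [Real.add_one_le_exp (a x), Real.add_one_le_exp (-a x),
    Real.exp_pos (a x), Real.exp_pos (-a x)]

theorem gaussianReal_prekopa_leindler {a b : ℝ → ℝ} {t c : ℝ} (ht : t ∈ Ioo (0 : ℝ) 1)
    (ha : Continuous a) (haint : Integrable (fun x => Real.exp (a x)) (gaussianReal 0 1))
    (hb : Continuous b) (hbint : Integrable (fun x => Real.exp (b x)) (gaussianReal 0 1))
    (hab : ∀ x y, (1 - t) * a x + t * b y ≤ c + t * (1 - t) / 2 * (x - y) ^ 2) :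
    (1 - t) * Real.log (∫ x, Real.exp (a x) ∂gaussianReal 0 1)
      + t * Real.log (∫ x, Real.exp (b x) ∂gaussianReal 0 1) ≤ c := by
  have hpdf : ∀ x : ℝ, gaussianPDFReal 0 1 x = Real.exp (-x ^ 2 / 2 - Real.log √(2 * Real.pi)) := by
    intro x
    rw [Real.exp_sub, Real.exp_log (by positivity), gaussianPDFReal]
    simp [div_eq_inv_mul]
  have hdens : ∀ f : ℝ → ℝ, Integrable (fun x => Real.exp (f x)) (gaussianReal 0 1) →
      Integrable (fun x => gaussianPDFReal 0 1 x * Real.exp (f x)) := by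
    intro f hf
    rw [gaussianReal_of_var_ne_zero _ one_ne_zero, integrable_withDensity_iff_integrable_smul'
      (measurable_gaussianPDF _ _) (ae_of_all _ fun _ => gaussianPDF_lt_top)] at hf
    simpa using hf
  have hpc : Continuous (gaussianPDFReal 0 1) := by
    rw [funext hpdf]; fun_prop
  have hpp : ∀ x, 0 < gaussianPDFReal 0 1 x := fun x => gaussianPDFReal_pos 0 1 x one_ne_zero
  have key := prekopa_leindler_real (h := fun x => Real.exp c * gaussianPDFReal 0 1 x) ht
    (hpc.mul (Real.continuous_exp.comp ha)) (fun x => mul_pos (hpp x) (Real.exp_pos _))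
    (hdens a haint)
    (hpc.mul (Real.continuous_exp.comp hb)) (fun x => mul_pos (hpp x) (Real.exp_pos _))
    (hdens b hbint) (fun x => (mul_pos (Real.exp_pos c) (hpp x)).le)
    ((integrable_gaussianPDFReal 0 1).const_mul _) ?_
  · have hA := integral_exp_pos haint
    have hB := integral_exp_pos hbint
    rw [integral_const_mul, integral_gaussianPDFReal_eq_one 0 one_ne_zero, mul_one] at key
    rw [integral_gaussianReal_eq_integral_smul one_ne_zero] at hA hB ⊢
    rw [integral_gaussianReal_eq_integral_smul one_ne_zero]
    simp only [smul_eq_mul] at hA hB ⊢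
    rw [← Real.log_rpow hA, ← Real.log_rpow hB, ← Real.log_mul (Real.rpow_pos_of_pos hA _).ne'
      (Real.rpow_pos_of_pos hB _).ne', Real.log_le_iff_le_exp (by positivity)]
    exact key
  · intro x y
    simp only [Pi.mul_apply, Function.comp_apply, hpdf]
    rw [← Real.exp_add, ← Real.exp_add, ← Real.exp_add, ← Real.exp_mul, ← Real.exp_mul,
      ← Real.exp_add, Real.exp_le_exp]
    linarith [hab x y]

theorem integral_pi_fin_succ {n : ℕ} {f : (Fin (n + 1) → ℝ) → ℝ}
    (hf : Integrable f (Measure.pi fun _ : Fin (n + 1) => gaussianReal 0 1)) :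
    ∫ x, f x ∂(Measure.pi fun _ : Fin (n + 1) => gaussianReal 0 1)
      = ∫ y, ∫ s, f (Fin.cons s y) ∂gaussianReal 0 1
          ∂(Measure.pi fun _ : Fin n => gaussianReal 0 1) := by
  have e := (measurePreserving_piFinSuccAbove (fun _ : Fin (n + 1) => gaussianReal 0 1) 0).symm
  have hint := (e.integrable_comp_emb (MeasurableEquiv.measurableEmbedding _)).2 hf
  rw [← e.integral_comp (MeasurableEquiv.measurableEmbedding _)]
  refine (integral_prod_symm _ hint).trans ?_
  simp [MeasurableEquiv.piFinSuccAbove, Fin.consEquiv]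

theorem lipschitzWith_cons_left {n : ℕ} {K : NNReal} {a : (Fin (n + 1) → ℝ) → ℝ}
    (ha : LipschitzWith K a) (y : Fin n → ℝ) :
    LipschitzWith K fun s : ℝ => a (Fin.cons s y : Fin (n + 1) → ℝ) := by
  refine LipschitzWith.of_dist_le_mul fun s r => (ha.dist_le_mul _ _).trans ?_
  gcongr
  refine (dist_pi_le_iff dist_nonneg).2 fun i => ?_
  refine Fin.cases ?_ (fun j => ?_) i <;> simp

theorem dist_cons_right_le {n : ℕ} {K : NNReal} {a : (Fin (n + 1) → ℝ) → ℝ}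
    (ha : LipschitzWith K a) (s : ℝ) (y z : Fin n → ℝ) :
    dist (a (Fin.cons s y : Fin (n + 1) → ℝ)) (a (Fin.cons s z : Fin (n + 1) → ℝ))
      ≤ K * dist y z := by
  refine (ha.dist_le_mul _ _).trans ?_
  gcongr
  refine (dist_pi_le_iff dist_nonneg).2 fun i => ?_
  refine Fin.cases (by simp) (fun j => ?_) i
  simpa using dist_le_pi_dist y z j

theorem integrable_exp_gaussianReal_of_lipschitzWith {K : NNReal} {a : ℝ → ℝ}
    (ha : LipschitzWith K a) :
    Integrable (fun s => Real.exp (a s)) (gaussianReal 0 1) := by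
  refine ((integrable_exp_mul_abs (t := K) (X := id) (integrable_exp_mul_gaussianReal _)
    (integrable_exp_mul_gaussianReal _)).const_mul (Real.exp (a 0))).mono'
    (Real.continuous_exp.comp ha.continuous).aestronglyMeasurable (ae_of_all _ fun x => ?_)
  rw [Real.norm_eq_abs, abs_of_pos (Real.exp_pos _), ← Real.exp_add, Real.exp_le_exp]
  have h3 := ha.dist_le_mul x 0
  rw [Real.dist_eq, Real.dist_eq, sub_zero] at h3
  simp only [id]
  linarith [le_abs_self (a x - a 0)]

theorem lipschitzWith_log_integral_exp {n : ℕ} {K : NNReal} {a : (Fin (n + 1) → ℝ) → ℝ}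
    (ha : LipschitzWith K a) :
    LipschitzWith K fun y : Fin n → ℝ =>
      Real.log (∫ s, Real.exp (a (Fin.cons s y)) ∂gaussianReal 0 1) := by
  have hint := fun y => integrable_exp_gaussianReal_of_lipschitzWith (lipschitzWith_cons_left ha y)
  refine LipschitzWith.of_le_add_mul K fun y z => ?_
  have hz := integral_exp_pos (hint z)
  have hy := integral_exp_pos (hint y)
  rw [Real.log_le_iff_le_exp hy, Real.exp_add, Real.exp_log hz, mul_comm, ← integral_const_mul]
  refine integral_mono (hint y) ((hint z).const_mul _) fun s => ?_
  simp only
  rw [← Real.exp_add, Real.exp_le_exp]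
  have := dist_cons_right_le ha s y z
  rw [Real.dist_eq] at this
  linarith [le_abs_self (a (Fin.cons s y : Fin (n + 1) → ℝ) - a (Fin.cons s z : Fin (n + 1) → ℝ))]

/-- A Gaussian form of the Prékopa–Leindler inequality for Lipschitz exponents. -/
theorem gaussian_prekopa_leindler {n : ℕ} {K L : NNReal} {a b : (Fin n → ℝ) → ℝ} {t c : ℝ}
    (ht : t ∈ Ioo (0 : ℝ) 1) (ha : LipschitzWith K a) (hb : LipschitzWith L b)
    (hab : ∀ x y, (1 - t) * a x + t * b y ≤ c + t * (1 - t) / 2 * ∑ i, (x i - y i) ^ 2) :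
    (1 - t) * Real.log (∫ x, Real.exp (a x) ∂(Measure.pi fun _ : Fin n => gaussianReal 0 1))
      + t * Real.log (∫ x, Real.exp (b x) ∂(Measure.pi fun _ : Fin n => gaussianReal 0 1))
      ≤ c := by
  induction n generalizing c with
  | zero =>
    rw [Measure.pi_of_empty _ default]
    simpa using hab default default
  | succ n ih =>
    have hfib : ∀ {M : NNReal} {f : (Fin (n + 1) → ℝ) → ℝ}, LipschitzWith M f →
        ∫ x, Real.exp (f x) ∂(Measure.pi fun _ : Fin (n + 1) => gaussianReal 0 1)
          = ∫ y, Real.exp (Real.log (∫ s, Real.exp (f (Fin.cons s y)) ∂gaussianReal 0 1))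
              ∂(Measure.pi fun _ : Fin n => gaussianReal 0 1) := by
      intro M f hf
      rw [integral_pi_fin_succ (integrable_exp_of_lipschitzWith hf)]
      congr 1 with y
      rw [Real.exp_log (integral_exp_pos
        (integrable_exp_gaussianReal_of_lipschitzWith (lipschitzWith_cons_left hf y)))]
    rw [hfib ha, hfib hb]
    refine ih (lipschitzWith_log_integral_exp ha) (lipschitzWith_log_integral_exp hb) fun x y => ?_
    have hax := lipschitzWith_cons_left ha x
    have hby := lipschitzWith_cons_left hb y
    refine gaussianReal_prekopa_leindler ht hax.continuous
      (integrable_exp_gaussianReal_of_lipschitzWith hax) hby.continuous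
      (integrable_exp_gaussianReal_of_lipschitzWith hby) fun s r => ?_
    have := hab (Fin.cons s x) (Fin.cons r y)
    rw [Fin.sum_univ_succ] at this
    simp only [Fin.cons_zero, Fin.cons_succ] at this
    linarith

/-- Gaussian concentration: a Lipschitz function of a standard Gaussian vector is subgaussian,
with the sharp constant given by its Euclidean Lipschitz constant. -/
theorem log_integral_exp_le_of_lipschitz {n : ℕ} {K : NNReal} {f : (Fin n → ℝ) → ℝ} {r : ℝ}
    (hf : LipschitzWith K f)
    (hfr : ∀ x y, f x - f y ≤ r * √(∑ i, (x i - y i) ^ 2)) :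
    Real.log (∫ x, Real.exp (f x) ∂(Measure.pi fun _ : Fin n => gaussianReal 0 1))
      ≤ (∫ x, f x ∂(Measure.pi fun _ : Fin n => gaussianReal 0 1)) + r ^ 2 / 2 := by
  set μ := Measure.pi fun _ : Fin n => gaussianReal 0 1
  have hbound : ∀ t ∈ Ioo (0 : ℝ) 1,
      Real.log (∫ x, Real.exp (f x) ∂μ) ≤ (∫ x, f x ∂μ) + r ^ 2 / 2 / (1 - t) := by
    intro t ht
    have ht0 : 0 < t := ht.1
    have ht1 : 0 < 1 - t := by linarith [ht.2]
    have hg : LipschitzWith (‖-(t / (1 - t))‖₊ * K) fun x => -(t / (1 - t)) * f x :=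
      (lipschitzWith_smul (-(t / (1 - t)))).comp hf
    have key := gaussian_prekopa_leindler (c := t * (r ^ 2 / 2 / (1 - t))) ht hg hf ?_
    · have hjensen : Real.exp (∫ x, -(t / (1 - t)) * f x ∂μ)
          ≤ ∫ x, Real.exp (-(t / (1 - t)) * f x) ∂μ :=
        convexOn_exp.map_integral_le Real.continuous_exp.continuousOn isClosed_univ (by simp)
          (integrable_of_lipschitzWith hg) (integrable_exp_of_lipschitzWith hg)
      rw [← Real.le_log_iff_exp_le (integral_exp_pos (integrable_exp_of_lipschitzWith hg)),
        integral_const_mul] at hjensen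
      have h1 := mul_le_mul_of_nonneg_left hjensen ht1.le
      have h2 : (1 - t) * (-(t / (1 - t)) * ∫ x, f x ∂μ) = -(t * ∫ x, f x ∂μ) := by
        field_simp
      refine le_of_mul_le_mul_left ?_ ht0
      linarith
    · intro x y
      set d := √(∑ i, (x i - y i) ^ 2) with hd
      have hd2 : d ^ 2 = ∑ i, (x i - y i) ^ 2 :=
        Real.sq_sqrt (Finset.sum_nonneg fun i _ => sq_nonneg _)
      have hxy : f y - f x ≤ r * d := by
        have := hfr y x
        rwa [show ∑ i, (y i - x i) ^ 2 = ∑ i, (x i - y i) ^ 2 from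
          Finset.sum_congr rfl fun i _ => by ring] at this
      rw [← hd2]
      have h2 : (1 - t) * (-(t / (1 - t)) * f x) = -(t * f x) := by
        field_simp
      rw [h2]
      have h3 : t * (r ^ 2 / 2 / (1 - t)) + t * (1 - t) / 2 * d ^ 2 - t * (r * d)
          = t / (2 * (1 - t)) * (r - (1 - t) * d) ^ 2 := by
        field_simp
        ring
      have h4 : 0 ≤ t / (2 * (1 - t)) * (r - (1 - t) * d) ^ 2 := by positivity
      have h5 := mul_le_mul_of_nonneg_left hxy ht0.le
      linarith
  have hlim : Tendsto (fun t : ℝ => (∫ x, f x ∂μ) + r ^ 2 / 2 / (1 - t)) (𝓝[>] 0)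
      (𝓝 ((∫ x, f x ∂μ) + r ^ 2 / 2 / (1 - 0))) := by
    have : ContinuousAt (fun t : ℝ => (∫ x, f x ∂μ) + r ^ 2 / 2 / (1 - t)) 0 := by
      fun_prop (disch := norm_num)
    exact this.tendsto.mono_left nhdsWithin_le_nhds
  rw [sub_zero, div_one] at hlim
  refine ge_of_tendsto hlim ?_
  filter_upwards [Ioo_mem_nhdsGT (zero_lt_one' ℝ)] with t ht using hbound t ht

/-- The support function `g ↦ sup_{u ∈ T} ⟪g, u⟫`. -/
noncomputable def gaussianSup {p : ℕ} (T : Set (EuclideanSpace ℝ (Fin p))) (g : Fin p → ℝ) : ℝ :=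
  sSup ((fun u : EuclideanSpace ℝ (Fin p) => ∑ i, g i * u i) '' T)

theorem sum_mul_le_sqrt_mul_norm {p : ℕ} (g : Fin p → ℝ) (u : EuclideanSpace ℝ (Fin p)) :
    ∑ i, g i * u i ≤ √(∑ i, g i ^ 2) * ‖u‖ := by
  rw [EuclideanSpace.norm_eq]
  simpa using Real.sum_mul_le_sqrt_mul_sqrt Finset.univ g u

theorem bddAbove_image_of_norm_le {p : ℕ} {T : Set (EuclideanSpace ℝ (Fin p))}
    (hT : ∀ u ∈ T, ‖u‖ ≤ 1) (g : Fin p → ℝ) :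
    BddAbove ((fun u : EuclideanSpace ℝ (Fin p) => ∑ i, g i * u i) '' T) := by
  refine ⟨√(∑ i, g i ^ 2), ?_⟩
  rintro _ ⟨u, hu, rfl⟩
  exact (sum_mul_le_sqrt_mul_norm g u).trans (mul_le_of_le_one_right (Real.sqrt_nonneg _) (hT u hu))

theorem gaussianSup_sub_le {p : ℕ} {T : Set (EuclideanSpace ℝ (Fin p))} (hne : T.Nonempty)
    (hT : ∀ u ∈ T, ‖u‖ ≤ 1) (x y : Fin p → ℝ) :
    gaussianSup T x - gaussianSup T y ≤ √(∑ i, (x i - y i) ^ 2) := by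
  rw [sub_le_iff_le_add]
  refine csSup_le (hne.image _) ?_
  rintro _ ⟨u, hu, rfl⟩
  have h1 := le_csSup (bddAbove_image_of_norm_le hT y) (mem_image_of_mem _ hu)
  have h2 := (sum_mul_le_sqrt_mul_norm (fun i => x i - y i) u).trans
    (mul_le_of_le_one_right (Real.sqrt_nonneg _) (hT u hu))
  simp only [sub_mul, Finset.sum_sub_distrib] at h1 h2
  change _ ≤ gaussianSup T y at h1
  linarith

theorem sqrt_sum_sq_sub_le {p : ℕ} (x y : Fin p → ℝ) :
    √(∑ i, (x i - y i) ^ 2) ≤ √p * dist x y := by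
  rw [Real.sqrt_le_left (by positivity), mul_pow, Real.sq_sqrt (Nat.cast_nonneg p)]
  calc ∑ i, (x i - y i) ^ 2 ≤ ∑ _i : Fin p, dist x y ^ 2 := by
        refine Finset.sum_le_sum fun i _ => ?_
        rw [← sq_abs, ← Real.dist_eq]
        gcongr
        exact dist_le_pi_dist x y i
    _ = p * dist x y ^ 2 := by simp

theorem lipschitzWith_gaussianSup {p : ℕ} {T : Set (EuclideanSpace ℝ (Fin p))} (hne : T.Nonempty)
    (hT : ∀ u ∈ T, ‖u‖ ≤ 1) : LipschitzWith (NNReal.sqrt p) (gaussianSup T) := by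
  refine LipschitzWith.of_le_add_mul _ fun x y => ?_
  have h1 := gaussianSup_sub_le hne hT x y
  have h2 := sqrt_sum_sq_sub_le x y
  rw [Real.coe_sqrt, NNReal.coe_natCast]
  linarith

theorem integral_exp_gaussianSup_le {p : ℕ} {T : Set (EuclideanSpace ℝ (Fin p))}
    (hne : T.Nonempty) (hT : ∀ u ∈ T, ‖u‖ ≤ 1) {r : ℝ} (hr : 0 ≤ r) :
    ∫ g, Real.exp (r * gaussianSup T g) ∂(Measure.pi fun _ : Fin p => gaussianReal 0 1)
      ≤ Real.exp (r * gaussianWidth T + r ^ 2 / 2) := by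
  have hlip : LipschitzWith (‖r‖₊ * NNReal.sqrt p) fun g => r * gaussianSup T g :=
    (lipschitzWith_smul r).comp (lipschitzWith_gaussianSup hne hT)
  rw [← Real.log_le_iff_le_exp (integral_exp_pos (integrable_exp_of_lipschitzWith hlip))]
  have h := log_integral_exp_le_of_lipschitz hlip fun x y => by
    rw [← mul_sub]
    exact mul_le_mul_of_nonneg_left (gaussianSup_sub_le hne hT x y) hr
  rwa [integral_const_mul] at h

theorem mul_gaussianWidth_le {p k : ℕ} (hk : 1 ≤ k) {H : Set (EuclideanSpace ℝ (Fin p))}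
    {T : Fin k → Set (EuclideanSpace ℝ (Fin p))} (hH : H.Nonempty) (hH1 : ∀ u ∈ H, ‖u‖ ≤ 1)
    (hT : ∀ i, (T i).Nonempty) (hT1 : ∀ i, ∀ u ∈ T i, ‖u‖ ≤ 1)
    (hle : ∀ g, ∃ i, gaussianSup H g ≤ gaussianSup (T i) g) {r : ℝ} (hr : 0 ≤ r) :
    r * gaussianWidth H ≤ Real.log k + r * (⨆ i, gaussianWidth (T i)) + r ^ 2 / 2 := by
  set μ := Measure.pi fun _ : Fin p => gaussianReal 0 1
  have hlip : ∀ {S : Set (EuclideanSpace ℝ (Fin p))}, S.Nonempty → (∀ u ∈ S, ‖u‖ ≤ 1) →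
      LipschitzWith (‖r‖₊ * NNReal.sqrt p) fun g => r * gaussianSup S g := fun h h1 =>
    (lipschitzWith_smul r).comp (lipschitzWith_gaussianSup h h1)
  have hk0 : (0 : ℝ) < k := by exact_mod_cast hk
  set m := ⨆ i, gaussianWidth (T i)
  rw [← Real.exp_le_exp]
  calc Real.exp (r * gaussianWidth H)
      = Real.exp (∫ g, r * gaussianSup H g ∂μ) := by
        rw [integral_const_mul]; rfl
    _ ≤ ∫ g, Real.exp (r * gaussianSup H g) ∂μ :=
        convexOn_exp.map_integral_le Real.continuous_exp.continuousOn isClosed_univ (by simp)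
          (integrable_of_lipschitzWith (hlip hH hH1))
          (integrable_exp_of_lipschitzWith (hlip hH hH1))
    _ ≤ ∫ g, ∑ i, Real.exp (r * gaussianSup (T i) g) ∂μ := by
        refine integral_mono (integrable_exp_of_lipschitzWith (hlip hH hH1))
          (integrable_finsetSum _ fun i _ =>
            integrable_exp_of_lipschitzWith (hlip (hT i) (hT1 i))) fun g => ?_
        obtain ⟨i, hi⟩ := hle g
        refine le_trans (Real.exp_le_exp.2 (mul_le_mul_of_nonneg_left hi hr)) ?_
        exact Finset.single_le_sum (f := fun i => Real.exp (r * gaussianSup (T i) g))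
          (fun i _ => (Real.exp_pos _).le) (Finset.mem_univ i)
    _ = ∑ i, ∫ g, Real.exp (r * gaussianSup (T i) g) ∂μ :=
        integral_finsetSum _ fun i _ => integrable_exp_of_lipschitzWith (hlip (hT i) (hT1 i))
    _ ≤ ∑ _i : Fin k, Real.exp (r * m + r ^ 2 / 2) := by
        refine Finset.sum_le_sum fun i _ => (integral_exp_gaussianSup_le (hT i) (hT1 i) hr).trans ?_
        have := le_ciSup (Set.finite_range fun i => gaussianWidth (T i)).bddAbove i
        gcongr
    _ = Real.exp (Real.log k + r * m + r ^ 2 / 2) := by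
        rw [add_assoc, Real.exp_add (Real.log k), Real.exp_log hk0]
        simp

theorem nonempty_inter_sphere {p : ℕ} {C : Set (EuclideanSpace ℝ (Fin p))} (hC : IsCone C)
    (hne : ∃ x ∈ C, x ≠ 0) : (C ∩ {v | ‖v‖ = 1}).Nonempty := by
  obtain ⟨x, hx, hx0⟩ := hne
  refine ⟨‖x‖⁻¹ • x, hC.2 _ (by positivity) x hx, ?_⟩
  rw [mem_ofPred_eq, norm_smul, norm_inv, norm_norm, inv_mul_cancel₀ (norm_ne_zero_iff.2 hx0)]

theorem sum_mul_le_norm_mul_gaussianSup {p : ℕ} {C : Set (EuclideanSpace ℝ (Fin p))}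
    (hC : IsCone C) (g : Fin p → ℝ) {v : EuclideanSpace ℝ (Fin p)} (hv : v ∈ C) :
    ∑ j, g j * v j ≤ ‖v‖ * gaussianSup (C ∩ {v | ‖v‖ = 1}) g := by
  rcases eq_or_ne v 0 with rfl | hv0
  · simp
  have hpos : 0 < ‖v‖ := norm_pos_iff.2 hv0
  have hmem : ‖v‖⁻¹ • v ∈ C ∩ {v | ‖v‖ = 1} := by
    refine ⟨hC.2 _ (by positivity) v hv, ?_⟩
    rw [mem_ofPred_eq, norm_smul, norm_inv, norm_norm, inv_mul_cancel₀ hpos.ne']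
  have h := le_csSup (bddAbove_image_of_norm_le (fun u hu => le_of_eq hu.2) g)
    (mem_image_of_mem _ hmem)
  change _ ≤ gaussianSup (C ∩ {v | ‖v‖ = 1}) g at h
  rw [← div_le_iff₀' hpos]
  refine le_trans (le_of_eq ?_) h
  simp only [PiLp.smul_apply, smul_eq_mul, div_eq_inv_mul, Finset.mul_sum]
  exact Finset.sum_congr rfl fun i _ => by ring

/-- For closed cones `C₁,…,C_k`, each containing a nonzero vector, with
`H = {Σ u_i : u_i ∈ C_i, Σ‖u_i‖ = 1}`, the Gaussian width satisfies
`w(H) ≤ max_i w(C_i ∩ S^{p-1}) + √(2 log k) + √(π/2)`. -/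
theorem statement7 {p k : ℕ} (hk : 1 ≤ k)
    (C : Fin k → Set (EuclideanSpace ℝ (Fin p)))
    (hC : ∀ i, IsCone (C i)) (hclosed : ∀ i, IsClosed (C i))
    (hne : ∀ i, ∃ x ∈ C i, x ≠ 0) :
    gaussianWidth {u | ∃ v : Fin k → EuclideanSpace ℝ (Fin p),
        (∀ i, v i ∈ C i) ∧ (∑ i, ‖v i‖) = 1 ∧ u = ∑ i, v i}
      ≤ (⨆ i, gaussianWidth (C i ∩ {v | ‖v‖ = 1}))
        + Real.sqrt (2 * Real.log k) + Real.sqrt (Real.pi / 2) := by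
  have hT := fun i => nonempty_inter_sphere (hC i) (hne i)
  set H : Set (EuclideanSpace ℝ (Fin p)) := {u | ∃ v : Fin k → EuclideanSpace ℝ (Fin p),
    (∀ i, v i ∈ C i) ∧ (∑ i, ‖v i‖) = 1 ∧ u = ∑ i, v i}
  have hH1 : ∀ u ∈ H, ‖u‖ ≤ 1 := by
    rintro _ ⟨v, -, hv, rfl⟩
    exact (norm_sum_le _ _).trans hv.le
  have hH : H.Nonempty := by
    obtain ⟨x, hx, hx1⟩ := hT ⟨0, hk⟩
    rw [mem_ofPred_eq] at hx1
    refine ⟨_, fun i => if i = ⟨0, hk⟩ then x else 0, fun i => ?_, ?_, rfl⟩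
    · dsimp only
      split_ifs with h
      · rwa [h]
      · exact (hC i).1
    · rw [Finset.sum_eq_single ⟨0, hk⟩] <;> simp +contextual [hx1]
  have hle : ∀ g, ∃ i, gaussianSup H g ≤ gaussianSup (C i ∩ {v | ‖v‖ = 1}) g := by
    intro g
    have : Nonempty (Fin k) := ⟨⟨0, hk⟩⟩
    obtain ⟨i, hi⟩ := Finite.exists_max fun i => gaussianSup (C i ∩ {v | ‖v‖ = 1}) g
    refine ⟨i, csSup_le (hH.image _) ?_⟩
    rintro _ ⟨_, ⟨v, hvC, hv, rfl⟩, rfl⟩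
    calc ∑ j, g j * (∑ l, v l) j = ∑ l, ∑ j, g j * v l j := by
          rw [Finset.sum_comm]
          simp [Finset.mul_sum]
      _ ≤ ∑ l, ‖v l‖ * gaussianSup (C i ∩ {v | ‖v‖ = 1}) g := by
          refine Finset.sum_le_sum fun l _ =>
            (sum_mul_le_norm_mul_gaussianSup (hC l) g (hvC l)).trans ?_
          gcongr
          exact hi l
      _ = gaussianSup (C i ∩ {v | ‖v‖ = 1}) g := by rw [← Finset.sum_mul, hv, one_mul]
  have hlog : 0 ≤ Real.log k := Real.log_natCast_nonneg k
  set s := √(2 * Real.log k) with hs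
  have hs0 : 0 ≤ s := Real.sqrt_nonneg _
  have hs2 : s ^ 2 = 2 * Real.log k := Real.sq_sqrt (by positivity)
  have hmain := mul_gaussianWidth_le hk hH hH1 hT (fun i u hu => le_of_eq hu.2) hle
    (r := s + 1) (by positivity)
  have hpi : 1 ≤ √(Real.pi / 2) := by
    rw [Real.one_le_sqrt]
    linarith [Real.pi_gt_three]
  refine le_of_mul_le_mul_left ?_ (by positivity : 0 < s + 1)
  nlinarith [mul_le_mul_of_nonneg_left hpi (by positivity : 0 ≤ s + 1)]
end

section
/- Let Q ∈ ℝ^{p×p} be an orthogonal matrix, M = max_{i,j} |Q_{ij}|, and let s₁, s₂ ≥ 1. Let θ₁* ∈ ℝ^p have at most s₁ nonzero entries and θ₂* ∈ ℝ^p be such that Qθ₂* has at most s₂ nonzero entries. Then for all Δ₁, Δ₂ ∈ ℝ^p with ‖θ₁* + Δ₁‖₁ ≤ ‖θ₁*‖₁ and ‖Q(θ₂* + Δ₂)‖₁ ≤ ‖Qθ₂*‖₁, one has |⟨Δ₁, Δ₂⟩| ≤ 4M√(s₁s₂) · ‖Δ₁‖₂‖Δ₂‖₂; in particular, if M ≤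 1/(8√(s₁s₂)), then ‖Δ₁ + Δ₂‖₂ ≥ (1/2)(‖Δ₁‖₂ + ‖Δ₂‖₂), i.e., structural coherence holds with ρ = 1/2. -/
open scoped RealInnerProductSpace BigOperators Matrix

/-- If `a` has at most `s` nonzero entries and adding `d` does not increase the `ℓ₁` norm of `a`,
then `‖d‖₁ ≤ 2 √s ‖d‖₂`. -/
theorem sum_abs_le_of_sparse_of_sum_abs_add_le {ι : Type*} [Fintype ι] (a d : ι → ℝ) (s : ℕ)
    (hs : (Finset.univ.filter fun i => a i ≠ 0).card ≤ s)
    (h : ∑ i, |a i + d i| ≤ ∑ i, |a i|) :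
    ∑ i, |d i| ≤ 2 * (√s * √(∑ i, d i ^ 2)) := by
  set S := Finset.univ.filter fun i => a i ≠ 0 with hS
  have pointwise (i : ι) : |d i| + |a i| ≤ |a i + d i| + 2 * (if a i ≠ 0 then |d i| else 0) := by
    split_ifs with hi
    · have := abs_sub_abs_le_abs_add (a i) (d i)
      linarith
    · rw [not_not] at hi
      simp [hi]
  have cone : ∑ i, |d i| ≤ 2 * ∑ i ∈ S, |d i| := by
    have := Finset.sum_le_sum fun i (_ : i ∈ Finset.univ) => pointwise i
    rw [Finset.sum_add_distrib, Finset.sum_add_distrib, ← Finset.mul_sum,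
      ← Finset.sum_filter, ← hS] at this
    linarith
  have cauchy : ∑ i ∈ S, |d i| ≤ √s * √(∑ i, d i ^ 2) := by
    rw [← Real.sqrt_mul (Nat.cast_nonneg s)]
    apply Real.le_sqrt_of_sq_le
    calc (∑ i ∈ S, |d i|) ^ 2 ≤ S.card * ∑ i ∈ S, |d i| ^ 2 := sq_sum_le_card_mul_sum_sq
      _ ≤ s * ∑ i, d i ^ 2 := by
        simp only [sq_abs]
        gcongr
        exact Finset.subset_univ S
  linarith

/-- A bilinear form whose matrix has entries bounded by `M` is bounded by `M` in `ℓ₁` norms. -/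
theorem abs_dotProduct_mulVec_le {m n : Type*} [Fintype m] [Fintype n] (A : Matrix m n ℝ) {M : ℝ}
    (hA : ∀ i j, |A i j| ≤ M) (u : m → ℝ) (v : n → ℝ) :
    |u ⬝ᵥ A *ᵥ v| ≤ M * ((∑ i, |u i|) * ∑ j, |v j|) := by
  simp only [dotProduct, Matrix.mulVec, Finset.mul_sum, Finset.sum_mul]
  rw [Finset.sum_comm]
  refine (Finset.abs_sum_le_sum_abs _ _).trans (Finset.sum_le_sum fun j _ => ?_)
  refine (Finset.abs_sum_le_sum_abs _ _).trans (Finset.sum_le_sum fun i _ => ?_)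
  rw [abs_mul, abs_mul]
  have := mul_le_mul_of_nonneg_right (hA i j) (mul_nonneg (abs_nonneg (u i)) (abs_nonneg (v j)))
  linarith

/-- Vectors with `|⟪x, y⟫| ≤ ‖x‖ ‖y‖ / 2` satisfy the reverse triangle inequality with
constant `1 / 2`. -/
theorem half_norm_add_norm_le_norm_add {E : Type*} [NormedAddCommGroup E] [InnerProductSpace ℝ E]
    {x y : E} (h : |⟪x, y⟫| ≤ 1 / 2 * (‖x‖ * ‖y‖)) :
    (1 / 2) * (‖x‖ + ‖y‖) ≤ ‖x + y‖ := by
  have hxy := norm_add_sq_real x y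
  have := neg_abs_le ⟪x, y⟫
  refine abs_le_of_sq_le_sq' ?_ (norm_nonneg _) |>.2
  nlinarith [sq_nonneg (‖x‖ - ‖y‖)]

/-- For an orthogonal matrix `Q` with `M = max_{i,j} |Q_{ij}|`, an
`s₁`-sparse `θ₁*` and `θ₂*` with `Qθ₂*` `s₂`-sparse, any `Δ₁, Δ₂` in the respective
`ℓ₁` error sets satisfy `|⟪Δ₁, Δ₂⟫| ≤ 4M√(s₁s₂)‖Δ₁‖₂‖Δ₂‖₂`; in particular, if
`M ≤ 1/(8√(s₁s₂))` then `‖Δ₁ + Δ₂‖₂ ≥ (1/2)(‖Δ₁‖₂ + ‖Δ₂‖₂)`. -/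
theorem statement13 {p : ℕ} (Q : Matrix (Fin p) (Fin p) ℝ) (hQ : Qᵀ * Q = 1)
    (M : ℝ) (hM : M = ⨆ i : Fin p, ⨆ j : Fin p, |Q i j|)
    (s₁ s₂ : ℕ) (hs₁ : 1 ≤ s₁) (hs₂ : 1 ≤ s₂)
    (θ₁ θ₂ : EuclideanSpace ℝ (Fin p))
    (hθ₁ : (Finset.univ.filter fun i => θ₁ i ≠ 0).card ≤ s₁)
    (hθ₂ : (Finset.univ.filter fun i => Q.mulVec θ₂ i ≠ 0).card ≤ s₂)
    (Δ₁ Δ₂ : EuclideanSpace ℝ (Fin p))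
    (hΔ₁ : (∑ i, |θ₁ i + Δ₁ i|) ≤ ∑ i, |θ₁ i|)
    (hΔ₂ : (∑ i, |Q.mulVec (θ₂ + Δ₂) i|) ≤ ∑ i, |Q.mulVec θ₂ i|) :
    |⟪Δ₁, Δ₂⟫| ≤ 4 * M * Real.sqrt ((s₁ : ℝ) * s₂) * (‖Δ₁‖ * ‖Δ₂‖) ∧
    (M ≤ 1 / (8 * Real.sqrt ((s₁ : ℝ) * s₂)) →
      (1 / 2) * (‖Δ₁‖ + ‖Δ₂‖) ≤ ‖Δ₁ + Δ₂‖) := by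
  have hQM (i j : Fin p) : |Q i j| ≤ M :=
    hM ▸ (le_ciSup (Finite.bddAbove_range fun j => |Q i j|) j).trans
      (le_ciSup (Finite.bddAbove_range fun i => ⨆ j, |Q i j|) i)
  have hM0 : 0 ≤ M := hM ▸ Real.iSup_nonneg fun i => Real.iSup_nonneg fun j => abs_nonneg _
  have norm_rotation : ∑ i, (Q *ᵥ Δ₂) i ^ 2 = ∑ i, Δ₂ i ^ 2 := by
    have : (Q *ᵥ Δ₂) ⬝ᵥ (Q *ᵥ Δ₂) = (Δ₂ : Fin p → ℝ) ⬝ᵥ Δ₂ := by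
      rw [Matrix.dotProduct_mulVec, Matrix.vecMul_mulVec, hQ, Matrix.vecMul_one]
    simpa only [dotProduct, ← sq] using this
  have l1_Δ₁ := sum_abs_le_of_sparse_of_sum_abs_add_le θ₁ Δ₁ s₁ hθ₁ hΔ₁
  have l1_QΔ₂ := sum_abs_le_of_sparse_of_sum_abs_add_le (Q *ᵥ θ₂) (Q *ᵥ Δ₂) s₂ hθ₂
    (by simpa [Matrix.mulVec_add] using hΔ₂)
  have norm_eq (x : EuclideanSpace ℝ (Fin p)) : √(∑ i, x i ^ 2) = ‖x‖ := by
    simp [EuclideanSpace.norm_eq]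
  rw [norm_rotation, norm_eq] at l1_QΔ₂
  rw [norm_eq] at l1_Δ₁
  have inner_eq : ⟪Δ₁, Δ₂⟫ = (Δ₁ : Fin p → ℝ) ⬝ᵥ Qᵀ *ᵥ (Q *ᵥ Δ₂) := by
    rw [Matrix.mulVec_mulVec, hQ, Matrix.one_mulVec, EuclideanSpace.inner_eq_star_dotProduct,
      dotProduct_comm, star_trivial]
  have bound : |⟪Δ₁, Δ₂⟫| ≤ 4 * M * √((s₁ : ℝ) * s₂) * (‖Δ₁‖ * ‖Δ₂‖) :=
    calc |⟪Δ₁, Δ₂⟫| ≤ M * ((∑ i, |Δ₁ i|) * ∑ j, |(Q *ᵥ Δ₂) j|) :=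
          inner_eq ▸ abs_dotProduct_mulVec_le Qᵀ (fun i j => hQM j i) _ _
      _ ≤ M * ((2 * (√s₁ * ‖Δ₁‖)) * (2 * (√s₂ * ‖Δ₂‖))) := by gcongr
      _ = 4 * M * √((s₁ : ℝ) * s₂) * (‖Δ₁‖ * ‖Δ₂‖) := by
        rw [Real.sqrt_mul (Nat.cast_nonneg s₁)]
        ring
  refine ⟨bound, fun hsmall => half_norm_add_norm_le_norm_add (bound.trans ?_)⟩
  have hpos : 0 < 8 * √((s₁ : ℝ) * s₂) := by positivity
  rw [le_div_iff₀ hpos] at hsmall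
  gcongr
  linarith
end

section
/- Let θ ∈ ℝ^p be 1-sparse with its unique nonzero entry at coordinate i (θ_i ≠ 0, θ_l = 0 for l ≠ i). Then every Δ ∈ ℝ^p with ‖θ + Δ‖₁ ≤ ‖θ‖₁ satisfies −sign(θ_i)·Δ_i ≥ Σ_{l ≠ i} |Δ_l|, and moreover −sign(θ_i)·Δ_i ≥ ‖Δ‖₂/√2. -/
open scoped BigOperators

/-- If `θ` is 1-sparse with nonzero entry at coordinate `i`, every
`Δ` with `‖θ + Δ‖₁ ≤ ‖θ‖₁` satisfies `-sign(θ_i)·Δ_i ≥ Σ_{l ≠ i} |Δ_l|` and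
`-sign(θ_i)·Δ_i ≥ ‖Δ‖₂/√2`. -/
theorem statement14 {p : ℕ} (θ : EuclideanSpace ℝ (Fin p)) (i : Fin p)
    (hi : θ i ≠ 0) (hsp : ∀ l, l ≠ i → θ l = 0)
    (Δ : EuclideanSpace ℝ (Fin p))
    (hΔ : (∑ l, |θ l + Δ l|) ≤ ∑ l, |θ l|) :
    (∑ l ∈ Finset.univ.erase i, |Δ l|) ≤ -(Real.sign (θ i) * Δ i) ∧
    ‖Δ‖ / Real.sqrt 2 ≤ -(Real.sign (θ i) * Δ i) := by
  have h₁ : (∑ l ∈ Finset.univ.erase i, |Δ l|) ≤ -(Real.sign (θ i) * Δ i) := by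
    rw [← Finset.add_sum_erase _ _ (Finset.mem_univ i),
      ← Finset.add_sum_erase _ (fun l => |θ l|) (Finset.mem_univ i)] at hΔ
    have hadd : ∑ l ∈ Finset.univ.erase i, |θ l + Δ l| = ∑ l ∈ Finset.univ.erase i, |Δ l| :=
      Finset.sum_congr rfl fun l hl => by rw [hsp l (Finset.ne_of_mem_erase hl), zero_add]
    have hzero : ∑ l ∈ Finset.univ.erase i, |θ l| = 0 :=
      Finset.sum_eq_zero fun l hl => by rw [hsp l (Finset.ne_of_mem_erase hl), abs_zero]
    rw [hadd, hzero] at hΔ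
    rcases hi.lt_or_gt with h | h
    · rw [Real.sign_of_neg h]
      rw [abs_of_neg h] at hΔ
      linarith [neg_le_abs (θ i + Δ i)]
    · rw [Real.sign_of_pos h]
      rw [abs_of_pos h] at hΔ
      linarith [le_abs_self (θ i + Δ i)]
  refine ⟨h₁, ?_⟩
  have hnonneg : 0 ≤ ∑ l ∈ Finset.univ.erase i, |Δ l| :=
    Finset.sum_nonneg fun l _ => abs_nonneg (Δ l)
  have hsq : ∑ l ∈ Finset.univ.erase i, Δ l ^ 2 ≤ (∑ l ∈ Finset.univ.erase i, |Δ l|) ^ 2 := by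
    simpa only [sq_abs] using
      Finset.sum_sq_le_sq_sum_of_nonneg (s := Finset.univ.erase i) fun l _ => abs_nonneg (Δ l)
  have hsign : (-(Real.sign (θ i) * Δ i)) ^ 2 = Δ i ^ 2 := by
    rcases Real.sign_apply_eq_of_ne_zero _ hi with h | h <;> rw [h] <;> ring
  rw [div_le_iff₀ (by positivity)]
  refine le_of_sq_le_sq ?_ (mul_nonneg (hnonneg.trans h₁) (Real.sqrt_nonneg 2))
  rw [mul_pow, Real.sq_sqrt zero_le_two, EuclideanSpace.real_norm_sq_eq,
    ← Finset.add_sum_erase _ _ (Finset.mem_univ i)]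
  linarith [pow_le_pow_left₀ hnonneg h₁ 2]
end
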